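/- Let K be a field of arbitrary characteristic, A a central line arrangement in K² with |A| = n, and m a multiplicity on A. Put exp(A,m) = (d₁,d₂) with d₁ ≤ d₂. If |m| ≤ 2n − 2, then d₁ = |m| − n + 1 and d₂ = n − 1. -/

import Mathlib

open MvPolynomial

variable {K : Type*} [Field K]

/-- A subset of `K × K` is a line through the origin. -/
def IsCentralLine (L : Set (K × K)) : Prop :=
  ∃ a b : K, (a, b) ≠ (0, 0) ∧ L = {p : K × K | a * p.1 + b * p.2 = 0}

/-- A central line arrangement: a finite set of lines through the origin of `K²`. -/
def IsCentralArr (A : Finset (Set (K × K))) : Prop :=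
  ∀ L ∈ A, IsCentralLine L

/-- The linear form `a·x + b·y` in `K[x,y]`. -/
noncomputable def lin2 (a b : K) : MvPolynomial (Fin 2) K :=
  C a * X 0 + C b * X 1

/-- The action on `f` of the derivation with coefficient vector `θ`. -/
noncomputable def applyDer2 (θ : Fin 2 → MvPolynomial (Fin 2) K)
    (f : MvPolynomial (Fin 2) K) : MvPolynomial (Fin 2) K :=
  ∑ i, θ i * pderiv i f

/-- `θ` belongs to `D(A,m)`, the logarithmic derivation module of the multiarrangement
`(A, m)`: `θ(α_H) ∈ S'·α_H^{m(H)}` for every `H ∈ A`. -/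
def InDm (A : Finset (Set (K × K))) (m : Set (K × K) → ℕ)
    (θ : Fin 2 → MvPolynomial (Fin 2) K) : Prop :=
  ∀ L ∈ A, ∀ a b : K, (a, b) ≠ (0, 0) →
    L = {p : K × K | a * p.1 + b * p.2 = 0} →
    ∃ g, applyDer2 θ (lin2 a b) = g * lin2 a b ^ m L

/-- A homogeneous derivation of degree `d` on `K[x,y]`. -/
def HomogDer2 (θ : Fin 2 → MvPolynomial (Fin 2) K) (d : ℕ) : Prop :=
  ∀ i, (θ i).IsHomogeneous d

/-- `exp(A,m) = (d₁,d₂)`: the free module `D(A,m)` has a homogeneous basis with degrees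
`d₁` and `d₂`. -/
def IsExpPair (A : Finset (Set (K × K))) (m : Set (K × K) → ℕ) (d₁ d₂ : ℕ) : Prop :=
  ∃ θ₁ θ₂ : Fin 2 → MvPolynomial (Fin 2) K,
    InDm A m θ₁ ∧ InDm A m θ₂ ∧ HomogDer2 θ₁ d₁ ∧ HomogDer2 θ₂ d₂ ∧
    ∀ θ : Fin 2 → MvPolynomial (Fin 2) K, InDm A m θ →
      ∃! cfs : MvPolynomial (Fin 2) K × MvPolynomial (Fin 2) K,
        θ = fun j => cfs.1 * θ₁ j + cfs.2 * θ₂ j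

/-- `|m| = ∑_{H ∈ A} m(H)`. -/
def msize (A : Finset (Set (K × K))) (m : Set (K × K) → ℕ) : ℕ := ∑ H ∈ A, m H

theorem lin2_isHomogeneous (a b : K) : (lin2 a b).IsHomogeneous 1 := by
  have h (c : K) (i : Fin 2) : (C c * X i : MvPolynomial (Fin 2) K).IsHomogeneous 1 := by
    simpa using (isHomogeneous_C (Fin 2) c).mul (isHomogeneous_X K i)
  exact (h a 0).add (h b 1)

theorem lin2_ne_zero {a b : K} (hab : (a, b) ≠ (0, 0)) : lin2 a b ≠ 0 := by
  intro h
  apply hab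
  have h0 := congrArg (eval ![1, 0]) h
  have h1 := congrArg (eval ![0, 1]) h
  simp [lin2] at h0 h1
  simp [h0, h1]

theorem irreducible_lin2 {a b : K} (hab : (a, b) ≠ (0, 0)) : Irreducible (lin2 a b) := by
  have h0 := lin2_ne_zero hab
  refine irreducible_of_totalDegree_eq_one ((lin2_isHomogeneous a b).totalDegree h0) ?_
  intro x hx
  obtain ⟨i, hi⟩ := ne_zero_iff.1 h0
  exact isUnit_iff_ne_zero.2 (ne_zero_of_dvd_ne_zero hi (hx i))

theorem mul_eq_mul_of_lin2_dvd {a b c d : K} (h : lin2 a b ∣ lin2 c d) : a * d = b * c := by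
  obtain ⟨q, hq⟩ := h
  have := congrArg (eval ![-b, a]) hq
  simp [lin2] at this
  have h2 : (a * b - b * a) = 0 := by ring
  linear_combination this + eval ![-b, a] q * h2

theorem exists_scalar_of_mul_eq_mul {a b c d : K} (hab : (a, b) ≠ (0, 0)) (hcd : (c, d) ≠ (0, 0))
    (h : a * d = b * c) : ∃ t : K, t ≠ 0 ∧ c = t * a ∧ d = t * b := by
  have key : ∃ t : K, c = t * a ∧ d = t * b := by
    by_cases ha : a = 0
    · subst ha
      have hb : b ≠ 0 := fun hb => hab (by simp [hb])
      have hc : c = 0 := by simpa [hb] using h.symm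
      exact ⟨d / b, by simp [hc], by field_simp⟩
    · exact ⟨c / a, by field_simp, by field_simp; linear_combination h⟩
  obtain ⟨t, hc, hd⟩ := key
  refine ⟨t, ?_, hc, hd⟩
  rintro rfl
  exact hcd (by simp [hc, hd])

theorem eq_of_lin2_dvd {a b c d : K} (hab : (a, b) ≠ (0, 0)) (hcd : (c, d) ≠ (0, 0))
    (h : lin2 a b ∣ lin2 c d) :
    {p : K × K | a * p.1 + b * p.2 = 0} = {p : K × K | c * p.1 + d * p.2 = 0} := by
  obtain ⟨t, ht, rfl, rfl⟩ := exists_scalar_of_mul_eq_mul hab hcd (mul_eq_mul_of_lin2_dvd h)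
  ext p
  simp only [Set.mem_ofPred_eq, mul_assoc, ← mul_add, mul_eq_zero, ht, false_or]

theorem applyDer2_lin2 (θ : Fin 2 → MvPolynomial (Fin 2) K) (a b : K) :
    applyDer2 θ (lin2 a b) = C a * θ 0 + C b * θ 1 := by
  simp [applyDer2, lin2, pderiv_X, Pi.single_apply]
  ring

theorem dvd_of_dvd_C_mul {a b : K} (hab : (a, b) ≠ (0, 0)) {p f : MvPolynomial (Fin 2) K}
    (ha : p ∣ C a * f) (hb : p ∣ C b * f) : p ∣ f := by
  by_cases h : a = 0
  · have hb0 : b ≠ 0 := fun hb0 => hab (by simp [h, hb0])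
    exact ((hb0.isUnit.map C).dvd_mul_left).1 hb
  · exact ((Ne.isUnit h).map C).dvd_mul_left.1 ha

/-- `a` and `b` give, for every line of `A`, the coefficients of a defining linear form. -/
def IsDefiningFamily (A : Finset (Set (K × K))) (a b : Set (K × K) → K) : Prop :=
  ∀ L ∈ A, (a L, b L) ≠ (0, 0) ∧ L = {p : K × K | a L * p.1 + b L * p.2 = 0}

theorem IsCentralArr.exists_isDefiningFamily {A : Finset (Set (K × K))} (hA : IsCentralArr A) :
    ∃ a b : Set (K × K) → K, IsDefiningFamily A a b := by
  choose! a b h using hA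
  exact ⟨a, b, h⟩

/-- The determinant of the coefficient matrix of two derivations. -/
noncomputable def det2 (θ φ : Fin 2 → MvPolynomial (Fin 2) K) : MvPolynomial (Fin 2) K :=
  θ 0 * φ 1 - θ 1 * φ 0

namespace IsDefiningFamily

variable {A : Finset (Set (K × K))} {a b : Set (K × K) → K} {m : Set (K × K) → ℕ}
  {θ φ : Fin 2 → MvPolynomial (Fin 2) K}

theorem inDm_iff (h : IsDefiningFamily A a b) :
    InDm A m θ ↔ ∀ L ∈ A, lin2 (a L) (b L) ^ m L ∣ C (a L) * θ 0 + C (b L) * θ 1 := by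
  constructor
  · intro hθ L hL
    obtain ⟨g, hg⟩ := hθ L hL (a L) (b L) (h L hL).1 (h L hL).2
    rw [applyDer2_lin2] at hg
    exact ⟨g, hg.trans (mul_comm _ _)⟩
  · intro hθ L hL c d hcd hLcd
    have hmem : c * -b L + d * a L = 0 :=
      (Set.ext_iff.1 ((h L hL).2.symm.trans hLcd) (-b L, a L)).1
        (show a L * -b L + b L * a L = 0 by ring)
    have hprop : a L * d = b L * c := by linear_combination hmem
    obtain ⟨t, ht, rfl, rfl⟩ := exists_scalar_of_mul_eq_mul (h L hL).1 hcd hprop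
    have hlin : lin2 (t * a L) (t * b L) = C t * lin2 (a L) (b L) := by
      simp only [lin2, C_mul]
      ring
    have hdvd : lin2 (t * a L) (t * b L) ^ m L ∣ applyDer2 θ (lin2 (t * a L) (t * b L)) := by
      rw [hlin, mul_pow, (((ht.isUnit.map C).pow _).mul_left_dvd), ← hlin, applyDer2_lin2,
        C_mul, C_mul]
      obtain ⟨g, hg⟩ := hθ L hL
      exact ⟨C t * g, by linear_combination C t * hg⟩
    obtain ⟨g, hg⟩ := hdvd
    exact ⟨g, hg.trans (mul_comm _ _)⟩

theorem prod_pow_ne_zero (h : IsDefiningFamily A a b) (k : Set (K × K) → ℕ) :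
    ∏ L ∈ A, lin2 (a L) (b L) ^ k L ≠ 0 :=
  Finset.prod_ne_zero_iff.2 fun L hL => pow_ne_zero _ (lin2_ne_zero (h L hL).1)

theorem totalDegree_prod_pow (h : IsDefiningFamily A a b) (k : Set (K × K) → ℕ) :
    (∏ L ∈ A, lin2 (a L) (b L) ^ k L).totalDegree = ∑ L ∈ A, k L := by
  refine IsHomogeneous.totalDegree ?_ (h.prod_pow_ne_zero k)
  refine IsHomogeneous.prod _ _ _ fun L _ => ?_
  simpa using (lin2_isHomogeneous (a L) (b L)).pow (k L)

theorem isRelPrime_lin2 (h : IsDefiningFamily A a b) {L M : Set (K × K)} (hL : L ∈ A)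
    (hM : M ∈ A) (hne : L ≠ M) : IsRelPrime (lin2 (a L) (b L)) (lin2 (a M) (b M)) := by
  refine (irreducible_lin2 (h L hL).1).isRelPrime_iff_not_dvd.2 fun hdvd => hne ?_
  rw [(h L hL).2, (h M hM).2]
  exact eq_of_lin2_dvd (h L hL).1 (h M hM).1 hdvd

theorem prod_pow_dvd (h : IsDefiningFamily A a b) (k : Set (K × K) → ℕ)
    {f : MvPolynomial (Fin 2) K} (hf : ∀ L ∈ A, lin2 (a L) (b L) ^ k L ∣ f) :
    ∏ L ∈ A, lin2 (a L) (b L) ^ k L ∣ f :=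
  Finset.prod_dvd_of_isRelPrime
    (fun _ hL _ hM hne => (h.isRelPrime_lin2 hL hM hne).pow_left.pow_right) hf

theorem prod_pow_dvd_det2 (h : IsDefiningFamily A a b) (hθ : InDm A m θ) (hφ : InDm A m φ) :
    ∏ L ∈ A, lin2 (a L) (b L) ^ m L ∣ det2 θ φ := by
  refine h.prod_pow_dvd m fun L hL => ?_
  have h1 := h.inDm_iff.1 hθ L hL
  have h2 := h.inDm_iff.1 hφ L hL
  refine dvd_of_dvd_C_mul (h L hL).1 ?_ ?_
  · convert dvd_sub (h1.mul_right (φ 1)) (h2.mul_right (θ 1)) using 1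
    unfold det2
    ring
  · convert dvd_sub (h2.mul_right (θ 0)) (h1.mul_right (φ 0)) using 1
    unfold det2
    ring

open Classical in
theorem isUnit_of_dvd_prod_erase (h : IsDefiningFamily A a b) (hA : A.Nonempty)
    {u : MvPolynomial (Fin 2) K}
    (hu : ∀ L ∈ A, u ∣ ∏ M ∈ A.erase L, lin2 (a M) (b M) ^ m M) : IsUnit u := by
  by_contra hunit
  obtain ⟨L, hL⟩ := hA
  have hP : ∏ M ∈ A.erase L, lin2 (a M) (b M) ^ m M ≠ 0 :=
    Finset.prod_ne_zero_iff.2 fun M hM =>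
      pow_ne_zero _ (lin2_ne_zero (h M (Finset.mem_of_mem_erase hM)).1)
  obtain ⟨p, hp, hpu⟩ :=
    WfDvdMonoid.exists_irreducible_factor hunit (ne_zero_of_dvd_ne_zero hP (hu L hL))
  obtain ⟨M, hM, hpM⟩ := hp.prime.exists_mem_finset_dvd (hpu.trans (hu L hL))
  have hMA := Finset.mem_of_mem_erase hM
  have hrel : IsRelPrime (lin2 (a M) (b M)) (∏ N ∈ A.erase M, lin2 (a N) (b N) ^ m N) :=
    IsRelPrime.prod_right fun N hN =>
      (h.isRelPrime_lin2 hMA (Finset.mem_of_mem_erase hN)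
        (Finset.ne_of_mem_erase hN).symm).pow_right
  exact hp.not_isUnit (hrel (hp.prime.dvd_of_dvd_pow hpM) (hpu.trans (hu M hMA)))

/-- One half of Saito's criterion: the determinant of a generating pair is a unit multiple of
the defining polynomial. -/
theorem det2_eq_mul_isUnit (h : IsDefiningFamily A a b) (hA : A.Nonempty)
    (hθ : InDm A m θ) (hφ : InDm A m φ)
    (hgen : ∀ ψ, InDm A m ψ → ∃ c d, ψ = fun j => c * θ j + d * φ j) :
    ∃ u, IsUnit u ∧ det2 θ φ = (∏ L ∈ A, lin2 (a L) (b L) ^ m L) * u := by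
  classical
  obtain ⟨u, hu⟩ := h.prod_pow_dvd_det2 hθ hφ
  refine ⟨u, h.isUnit_of_dvd_prod_erase (m := m) hA fun L hL => ?_, hu⟩
  set D := ∏ L ∈ A, lin2 (a L) (b L) ^ m L
  set P := ∏ M ∈ A.erase L, lin2 (a M) (b M) ^ m M
  have hdet {ψ χ : Fin 2 → MvPolynomial (Fin 2) K} (hψ : InDm A m ψ) (hχ : InDm A m χ) :
      det2 θ φ ∣ det2 ψ χ := by
    obtain ⟨c, d, rfl⟩ := hgen ψ hψ
    obtain ⟨c', d', rfl⟩ := hgen χ hχ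
    refine ⟨c * d' - d * c', ?_⟩
    unfold det2
    ring
  have hDdvd : ∀ M ∈ A, lin2 (a M) (b M) ^ m M ∣ D := fun M hM =>
    Finset.dvd_prod_of_mem (fun M => lin2 (a M) (b M) ^ m M) hM
  have hψ : InDm A m ![-C (b L) * P, C (a L) * P] := by
    refine h.inDm_iff.2 fun M hM => ?_
    by_cases hML : M = L
    · subst hML
      convert dvd_zero _ using 1
      simp
      ring
    · have hP : lin2 (a M) (b M) ^ m M ∣ P :=
        Finset.dvd_prod_of_mem (fun M => lin2 (a M) (b M) ^ m M) (Finset.mem_erase.2 ⟨hML, hM⟩)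
      exact dvd_add ((hP.mul_left _).mul_left _) ((hP.mul_left _).mul_left _)
  have hx : InDm A m ![D, 0] := h.inDm_iff.2 fun M hM =>
    dvd_add ((hDdvd M hM).mul_left _) ((dvd_zero _).mul_left _)
  have hy : InDm A m ![0, D] := h.inDm_iff.2 fun M hM =>
    dvd_add ((dvd_zero _).mul_left _) ((hDdvd M hM).mul_left _)
  have hDP : D * u ∣ D * P := by
    rw [← hu]
    refine dvd_of_dvd_C_mul (h L hL).1 ?_ ?_
    · convert (dvd_neg.2 (hdet hψ hx)) using 1
      simp [det2]
      ring
    · convert (dvd_neg.2 (hdet hψ hy)) using 1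
      simp [det2]
      ring
  exact (mul_dvd_mul_iff_left (h.prod_pow_ne_zero m)).1 hDP

/-- In degrees less than `|A| - 1`, every element of `D(A, m)` is a multiple of the Euler
derivation times `∏ α_H ^ (m H - 1)`. -/
theorem exists_eq_mul_euler (h : IsDefiningFamily A a b) (hm : ∀ L ∈ A, 1 ≤ m L)
    (hθ : InDm A m θ) {d : ℕ} (hd : HomogDer2 θ d) (hlt : d + 1 < A.card) :
    ∃ g, ∀ i, θ i = g * (∏ L ∈ A, lin2 (a L) (b L) ^ (m L - 1)) * X i := by
  have hw : X 0 * θ 1 - X 1 * θ 0 = 0 := by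
    by_contra hne
    have hdvd : ∏ L ∈ A, lin2 (a L) (b L) ^ 1 ∣ X 0 * θ 1 - X 1 * θ 0 := by
      refine h.prod_pow_dvd (fun _ => 1) fun L hL => ?_
      have h1 : lin2 (a L) (b L) ^ 1 ∣ C (a L) * θ 0 + C (b L) * θ 1 :=
        (pow_dvd_pow _ (hm L hL)).trans (h.inDm_iff.1 hθ L hL)
      have h2 : lin2 (a L) (b L) ^ 1 ∣ lin2 (a L) (b L) := by simp
      refine dvd_of_dvd_C_mul (h L hL).1 ?_ ?_
      · convert dvd_sub (h2.mul_right (θ 1)) (h1.mul_left (X 1)) using 1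
        unfold lin2
        ring
      · convert dvd_sub (h1.mul_left (X 0)) (h2.mul_right (θ 0)) using 1
        unfold lin2
        ring
    have hhom : (X 0 * θ 1 - X 1 * θ 0).IsHomogeneous (1 + d) :=
      ((isHomogeneous_X K 0).mul (hd 1)).sub ((isHomogeneous_X K 1).mul (hd 0))
    obtain ⟨q, hq⟩ := hdvd
    have hq0 : q ≠ 0 := by
      rintro rfl
      exact hne (by simpa using hq)
    have hdeg := hhom.totalDegree hne
    rw [hq, totalDegree_mul_of_isDomain (h.prod_pow_ne_zero fun _ => 1) hq0,
      h.totalDegree_prod_pow fun _ => 1] at hdeg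
    simp at hdeg
    omega
  have hX : (X 0 : MvPolynomial (Fin 2) K) ∣ X 1 * θ 0 := ⟨θ 1, by linear_combination -hw⟩
  have hX0 : (X 0 : MvPolynomial (Fin 2) K) ∣ θ 0 :=
    ((X_prime (i := 0)).dvd_or_dvd hX).resolve_left fun hdvd => by simp [X_dvd_X] at hdvd
  obtain ⟨f, hf⟩ := hX0
  have hf1 : θ 1 = X 1 * f := by
    refine mul_left_cancel₀ (X_ne_zero 0) ?_
    rw [hf] at hw
    linear_combination hw
  have hdvd : ∏ L ∈ A, lin2 (a L) (b L) ^ (m L - 1) ∣ f := by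
    refine h.prod_pow_dvd (fun L => m L - 1) fun L hL => ?_
    have h1 := h.inDm_iff.1 hθ L hL
    rw [hf, hf1, show C (a L) * (X 0 * f) + C (b L) * (X 1 * f) = lin2 (a L) (b L) * f by
      unfold lin2; ring, ← Nat.sub_add_cancel (hm L hL), pow_succ'] at h1
    exact (mul_dvd_mul_iff_left (lin2_ne_zero (h L hL).1)).1 h1
  obtain ⟨g, hg⟩ := hdvd
  refine ⟨g, Fin.forall_fin_two.2 ⟨?_, ?_⟩⟩
  · rw [hf, hg]
    ring
  · rw [hf1, hg]
    ring

theorem le_degree (h : IsDefiningFamily A a b) (hm : ∀ L ∈ A, 1 ≤ m L)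
    (hθ : InDm A m θ) {d : ℕ} (hd : HomogDer2 θ d) (hlt : d + 1 < A.card) (h0 : θ ≠ 0) :
    msize A m + 1 ≤ d + A.card := by
  obtain ⟨g, hg⟩ := h.exists_eq_mul_euler hm hθ hd hlt
  obtain ⟨i, hi⟩ := Function.ne_iff.1 h0
  have hg0 : g ≠ 0 := by
    rintro rfl
    exact hi (by simp [hg])
  have hdeg := (hd i).totalDegree hi
  have hE := h.prod_pow_ne_zero fun L => m L - 1
  rw [hg, totalDegree_mul_of_isDomain (mul_ne_zero hg0 hE) (X_ne_zero i),
    totalDegree_mul_of_isDomain hg0 hE, h.totalDegree_prod_pow fun L => m L - 1,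
    totalDegree_X] at hdeg
  have hsum : ∑ L ∈ A, (m L - 1) + A.card = msize A m := by
    rw [msize, Finset.card_eq_sum_ones, ← Finset.sum_add_distrib]
    exact Finset.sum_congr rfl fun L hL => Nat.sub_add_cancel (hm L hL)
  omega

end IsDefiningFamily

/-- **Lemma 2.8 (2)**. Let `A` be a central line arrangement with `|A| = n` and `m` a
multiplicity with `exp(A,m) = (d₁,d₂)`, `d₁ ≤ d₂`. If `|m| ≤ 2n − 2` then
`d₁ = |m| − n + 1` and `d₂ = n − 1`. -/
theorem exponents_eq_of_small_multiplicity
    {K : Type*} [Field K] (A : Finset (Set (K × K))) (hA : IsCentralArr A)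
    (n : ℕ) (hn : A.card = n)
    (m : Set (K × K) → ℕ) (hm : ∀ H ∈ A, 1 ≤ m H)
    (d₁ d₂ : ℕ) (hd : d₁ ≤ d₂) (hexp : IsExpPair A m d₁ d₂)
    (hsize : (msize A m : ℤ) ≤ 2 * (n : ℤ) - 2) :
    (d₁ : ℤ) = (msize A m : ℤ) - (n : ℤ) + 1 ∧ (d₂ : ℤ) = (n : ℤ) - 1 := by
  obtain ⟨a, b, h⟩ := hA.exists_isDefiningFamily
  obtain ⟨θ, φ, hθ, hφ, hθd, hφd, hgen⟩ := hexp
  have hA0 : A.Nonempty := Finset.card_pos.1 (by omega)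
  obtain ⟨u, hu, hdet⟩ := h.det2_eq_mul_isUnit hA0 hθ hφ fun ψ hψ =>
    let ⟨cfs, hcfs, _⟩ := hgen ψ hψ
    ⟨cfs.1, cfs.2, hcfs⟩
  have hdet0 : det2 θ φ ≠ 0 := hdet ▸ mul_ne_zero (h.prod_pow_ne_zero m) hu.ne_zero
  have hdeg : d₁ + d₂ = msize A m := by
    have hhom : (det2 θ φ).IsHomogeneous (d₁ + d₂) :=
      ((hθd 0).mul (hφd 1)).sub ((hθd 1).mul (hφd 0))
    rw [← hhom.totalDegree hdet0, hdet,
      totalDegree_mul_of_isDomain (h.prod_pow_ne_zero m) hu.ne_zero, h.totalDegree_prod_pow m,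
      (isUnit_iff_totalDegree_of_isReduced.1 hu).2, add_zero, msize]
  have hθ0 : θ ≠ 0 := by
    rintro rfl
    exact hdet0 (by simp [det2])
  have hd₂ : A.card ≤ d₂ + 1 := by
    by_contra! hlt
    obtain ⟨g, hg⟩ := h.exists_eq_mul_euler hm hθ hθd (by omega)
    obtain ⟨g', hg'⟩ := h.exists_eq_mul_euler hm hφ hφd hlt
    refine hdet0 ?_
    rw [det2, hg, hg, hg', hg']
    ring
  by_cases hlt : d₁ + 1 < A.card
  · have := h.le_degree hm hθ hθd hlt hθ0
    omega
  · omega
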